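/- arXiv:1612.00235 — 6 statements merged into one kernel-verified Lean document; each statement's English description precedes it below -/
import Mathlib

section
/- Let k ∈ ℕ (k ≥ 1) and let ε > 0, δ > 0. Then there exists a continuous doubly positive function f : ℝ → ℝ with ∫_{-1}^{1} f(x) dx > 0 such that ∫_{-(k+ε)}^{k+ε} f(x) dx ≥ (2k + 1 − δ) · ∫_{-1}^{1} f(x) dx. (In particular G(k+0) ≥ 2k+1, where G(ℓ) is the supremum over not identically zero doubly positive f of ∫_{-ℓ}^{ℓ} f / ∫_{-1}^{1} f.) -/
open MeasureTheory Real

/-- A function `f : ℝ → ℝ` is positive definite if for every `n`, all points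
`x 0, …, x (n-1)` and complex scalars `c 0, …, c (n-1)`, the real part of
`∑ i ∑ j, c i * conj (c j) * f (x i - x j)` is nonnegative. -/
def IsPosDefFn (f : ℝ → ℝ) : Prop :=
  ∀ (n : ℕ) (x : Fin n → ℝ) (c : Fin n → ℂ),
    0 ≤ (∑ i, ∑ j, c i * (starRingEnd ℂ) (c j) * (f (x i - x j) : ℂ)).re

/-- A function is doubly positive if it is positive definite and pointwise nonnegative. -/
def IsDoublyPos (f : ℝ → ℝ) : Prop :=
  IsPosDefFn f ∧ ∀ x, 0 ≤ f x

theorem IsPosDefFn.one : IsPosDefFn fun _ => 1 := by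
  intro n x c
  have h : ∑ i, ∑ j, c i * (starRingEnd ℂ) (c j) * ((1 : ℝ) : ℂ) =
      (∑ i, c i) * (starRingEnd ℂ) (∑ i, c i) := by
    simp [map_sum, Finset.sum_mul_sum]
  rw [h, Complex.mul_conj, Complex.ofReal_re]
  exact Complex.normSq_nonneg _

theorem IsPosDefFn.mul_cos {f : ℝ → ℝ} (hf : IsPosDefFn f) (a : ℝ) :
    IsPosDefFn fun x => f x * cos (a * x) := by
  intro n x c
  have h := add_nonneg (hf n x fun i => c i * (cos (a * x i) : ℝ))
    (hf n x fun i => c i * (sin (a * x i) : ℝ))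
  rw [← Complex.add_re, ← Finset.sum_add_distrib] at h
  refine h.trans_eq (congrArg Complex.re (Finset.sum_congr rfl fun i _ => ?_))
  rw [← Finset.sum_add_distrib]
  refine Finset.sum_congr rfl fun j _ => ?_
  dsimp only
  rw [mul_sub, cos_sub, map_mul, map_mul, Complex.conj_ofReal, Complex.conj_ofReal]
  push_cast
  ring

theorem isPosDefFn_cos_pow (a : ℝ) (n : ℕ) : IsPosDefFn fun x => cos (a * x) ^ n := by
  induction n with
  | zero => simpa using IsPosDefFn.one
  | succ n ih => simpa only [pow_succ] using ih.mul_cos a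

/-- A nonnegative periodic function has at least `2 * k + 1` copies of its integral over `[-r, r]`
in `[-(k * p + r), k * p + r]`. -/
theorem Function.Periodic.mul_integral_le {f : ℝ → ℝ} {p r : ℝ} (hp : Function.Periodic f p)
    (hc : Continuous f) (h0 : ∀ x, 0 ≤ f x) (hr : 0 ≤ r) (hrp : 2 * r ≤ p) (k : ℕ) :
    (2 * (k : ℝ) + 1) * ∫ x in (-r)..r, f x ≤ ∫ x in (-(k * p + r))..(k * p + r), f x := by
  have hi : ∀ a b, IntervalIntegrable f volume a b := fun a b => hc.intervalIntegrable a b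
  have hper : ∀ t, ∫ x in (-r)..r, f x ≤ ∫ x in t..(t + p), f x := fun t => by
    rw [hp.intervalIntegral_add_eq t (-r)]
    exact intervalIntegral.integral_mono_interval le_rfl (by linarith) (by linarith)
      (ae_of_all _ h0) (hi _ _)
  induction k with
  | zero => simp
  | succ k ih =>
    have h1 := hper (k * p + r)
    have h2 := hper (-((k + 1 : ℕ) * p + r))
    rw [show (k * p + r) + p = (k + 1 : ℕ) * p + r by push_cast; ring] at h1
    rw [show -((k + 1 : ℕ) * p + r) + p = -(k * p + r) by push_cast; ring] at h2
    have h3 := intervalIntegral.integral_add_adjacent_intervals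
      (hi (-((k + 1 : ℕ) * p + r)) (-(k * p + r))) (hi _ (k * p + r))
    have h4 := intervalIntegral.integral_add_adjacent_intervals
      (hi (-((k + 1 : ℕ) * p + r)) (k * p + r)) (hi _ ((k + 1 : ℕ) * p + r))
    push_cast at *
    linarith

theorem cos_sq_le_cos_sq_of_le_of_le {s t : ℝ} (hs : 0 ≤ s) (hst : s ≤ |t|) (ht : |t| ≤ π - s) :
    cos t ^ 2 ≤ cos s ^ 2 := by
  rw [← cos_abs t]
  refine sq_le_sq' ?_ (cos_le_cos_of_nonneg_of_le_pi hs (by linarith) hst)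
  have h := cos_le_cos_of_nonneg_of_le_pi hs (by linarith [abs_nonneg t] : π - |t| ≤ π)
    (by linarith)
  rw [cos_pi_sub] at h
  linarith

theorem exists_mul_pow_le_mul_pow {A B C D : ℝ} (hA : 0 < A) (hB : 0 ≤ B) (hBA : B < A)
    (hD : 0 < D) : ∃ n : ℕ, C * B ^ n ≤ D * A ^ n := by
  have h := (tendsto_pow_atTop_nhds_zero_of_lt_one (div_nonneg hB hA.le)
    ((div_lt_one hA).2 hBA)).const_mul C
  rw [mul_zero] at h
  obtain ⟨n, hn⟩ := (h.eventually (gt_mem_nhds hD)).exists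
  refine ⟨n, ?_⟩
  rw [div_pow, ← mul_div_assoc, div_lt_iff₀ (by positivity)] at hn
  exact hn.le

theorem lower_bound_G_right_limit (k : ℕ) (hk : 1 ≤ k) (ε δ : ℝ) (hε : 0 < ε) (hδ : 0 < δ) :
    ∃ f : ℝ → ℝ, Continuous f ∧ IsDoublyPos f ∧ (0 < ∫ x in (-1 : ℝ)..1, f x) ∧
      (2 * (k : ℝ) + 1 - δ) * ∫ x in (-1 : ℝ)..1, f x ≤
        ∫ x in (-((k : ℝ) + ε))..((k : ℝ) + ε), f x := by
  obtain ⟨r, hr, hr1, hrε⟩ : ∃ r : ℝ, 0 < r ∧ r ≤ 1 ∧ (2 * k + 1) * r ≤ ε := by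
    refine ⟨min 1 (ε / (2 * k + 1)), by positivity, min_le_left _ _, ?_⟩
    rw [mul_comm, ← le_div_iff₀ (by positivity)]
    exact min_le_right _ _
  set p := 1 + 2 * r with hp
  have hp0 : 0 < p := by positivity
  set a := π / p with ha
  have ha0 : 0 < a := by positivity
  have hap : a * p = π := div_mul_cancel₀ _ hp0.ne'
  have har : a * r < π / 2 := by nlinarith
  have hcos : 0 < cos (a * r) := cos_pos_of_mem_Ioo ⟨by nlinarith, har⟩
  have hcos_lt : cos (a * r) < cos (a * (r / 2)) :=
    cos_lt_cos_of_nonneg_of_le_pi (by positivity) (by linarith [pi_pos]) (by nlinarith)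
  have hcos' := hcos.trans hcos_lt
  obtain ⟨n, hn⟩ := exists_mul_pow_le_mul_pow (A := cos (a * (r / 2)) ^ 2)
    (B := cos (a * r) ^ 2) (C := (2 * k + 1) * 2) (D := δ * r) (by positivity)
    (by positivity) (by gcongr) (by positivity)
  let f : ℝ → ℝ := fun x => cos (a * x) ^ (2 * n)
  have hf : ∀ x, f x = (cos (a * x) ^ 2) ^ n := fun x => pow_mul _ _ _
  have hc : Continuous f := by fun_prop
  have h0 : ∀ x, 0 ≤ f x := fun x => by rw [hf]; positivity
  have hper : Function.Periodic f p := fun x => by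
    rw [hf, hf, mul_add, hap, cos_add_pi, neg_sq]
  have hi : ∀ u v, IntervalIntegrable f volume u v := fun u v => hc.intervalIntegrable u v
  have htail : ∀ x, r ≤ |x| → |x| ≤ 1 → f x ≤ (cos (a * r) ^ 2) ^ n := fun x h1 h2 => by
    rw [hf]
    refine pow_le_pow_left₀ (sq_nonneg _) (cos_sq_le_cos_sq_of_le_of_le (by positivity) ?_ ?_) n
    · rw [abs_mul, abs_of_pos ha0]; gcongr
    · rw [abs_mul, abs_of_pos ha0, ← hap, ← mul_sub]; gcongr; linarith
  have hpeak : r * (cos (a * (r / 2)) ^ 2) ^ n ≤ ∫ x in (-r)..r, f x := by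
    calc r * (cos (a * (r / 2)) ^ 2) ^ n
        = ∫ x in (-(r / 2))..(r / 2), (cos (a * (r / 2)) ^ 2) ^ n := by
          rw [intervalIntegral.integral_const, smul_eq_mul]; ring
      _ ≤ ∫ x in (-(r / 2))..(r / 2), f x := by
          refine intervalIntegral.integral_mono_on (by linarith) (by simp) (hi _ _)
            fun x hx => ?_
          rw [hf, ← cos_abs (a * x), abs_mul, abs_of_pos ha0]
          have hx' : |x| ≤ r / 2 := abs_le.2 hx
          have : cos (a * (r / 2)) ≤ cos (a * |x|) :=
            cos_le_cos_of_nonneg_of_le_pi (by positivity) (by linarith [pi_pos]) (by gcongr)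
          gcongr
      _ ≤ ∫ x in (-r)..r, f x :=
          intervalIntegral.integral_mono_interval (by linarith) (by linarith) (by linarith)
            (ae_of_all _ h0) (hi _ _)
  have hJL : ∫ x in (-r)..r, f x ≤ ∫ x in (-1 : ℝ)..1, f x :=
    intervalIntegral.integral_mono_interval (by linarith) (by linarith) hr1
      (ae_of_all _ h0) (hi _ _)
  have hLJ : ∫ x in (-1 : ℝ)..1, f x ≤
      (∫ x in (-r)..r, f x) + 2 * (cos (a * r) ^ 2) ^ n := by
    have hside : ∀ u v : ℝ, u ≤ v → v - u ≤ 1 → (∀ x ∈ Set.Icc u v, r ≤ |x| ∧ |x| ≤ 1) →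
        ∫ x in u..v, f x ≤ (cos (a * r) ^ 2) ^ n := fun u v huv huv1 h => by
      have hm := intervalIntegral.integral_mono_on (g := fun _ => (cos (a * r) ^ 2) ^ n) huv
        (hi _ _) (by simp) fun x hx => htail x (h x hx).1 (h x hx).2
      rw [intervalIntegral.integral_const, smul_eq_mul] at hm
      exact hm.trans (mul_le_of_le_one_left (by positivity) huv1)
    have h1 := intervalIntegral.integral_add_adjacent_intervals (hi (-1) (-r)) (hi _ r)
    have h2 := intervalIntegral.integral_add_adjacent_intervals (hi (-1) r) (hi _ 1)
    have hl := hside (-1) (-r) (by linarith) (by linarith) fun x hx =>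
      ⟨le_abs.2 (Or.inr (by linarith [hx.2])), abs_le.2 ⟨hx.1, by linarith [hx.2]⟩⟩
    have hr' := hside r 1 hr1 (by linarith) fun x hx =>
      ⟨le_abs.2 (Or.inl hx.1), abs_le.2 ⟨by linarith [hx.1], hx.2⟩⟩
    linarith
  have hpeak0 : 0 < r * (cos (a * (r / 2)) ^ 2) ^ n := by positivity
  refine ⟨f, hc, ⟨isPosDefFn_cos_pow a (2 * n), h0⟩, by linarith, ?_⟩
  have hkr : k * p + r ≤ k + ε := by rw [hp]; linarith
  have hkr0 : 0 ≤ k * p + r := by positivity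
  calc (2 * (k : ℝ) + 1 - δ) * ∫ x in (-1 : ℝ)..1, f x
      ≤ (2 * (k : ℝ) + 1) * ∫ x in (-r)..r, f x := by
        have h1 := mul_le_mul_of_nonneg_left hLJ (by positivity : 0 ≤ 2 * (k : ℝ) + 1)
        have h2 := mul_le_mul_of_nonneg_left hJL hδ.le
        have h3 := mul_le_mul_of_nonneg_left hpeak hδ.le
        linarith
    _ ≤ ∫ x in (-(k * p + r))..(k * p + r), f x :=
        hper.mul_integral_le hc h0 hr.le (by linarith) k
    _ ≤ ∫ x in (-((k : ℝ) + ε))..((k : ℝ) + ε), f x :=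
        intervalIntegral.integral_mono_interval (by linarith) (by linarith) hkr
          (ae_of_all _ h0) (hi _ _)
end

section
/- Let k ∈ ℕ, k ≥ 2, and let δ > 0. Then there exists a continuous doubly positive function f : ℝ → ℝ with ∫_{-1}^{1} f(x) dx > 0 such that ∫_{-k}^{k} f(x) dx ≥ (2k − 1 − δ) · ∫_{-1}^{1} f(x) dx. (In particular G(k) ≥ 2k − 1.) -/
open MeasureTheory Real

lemma isPosDefFn_one : IsPosDefFn (fun _ => 1) := by
  intro n x c
  have h : (∑ i, ∑ j, c i * (starRingEnd ℂ) (c j) * (((1 : ℝ)) : ℂ)) =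
      (∑ i, c i) * (starRingEnd ℂ) (∑ i, c i) := by
    simp [Finset.sum_mul_sum, map_sum]
  rw [h, Complex.mul_conj, Complex.ofReal_re]
  exact Complex.normSq_nonneg _

/-- Multiplication by `1 + cos (b x)` preserves positive definiteness. -/
lemma IsPosDefFn.one_add_cos_mul {f : ℝ → ℝ} (hf : IsPosDefFn f) (b : ℝ) :
    IsPosDefFn (fun x => (1 + cos (b * x)) * f x) := by
  intro n x c
  have h₀ := hf n x c
  have h₁ := hf n x (fun i => c i * Complex.exp ((b * x i : ℝ) * Complex.I))
  have h₂ := hf n x (fun i => c i * Complex.exp (-(b * x i : ℝ) * Complex.I))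
  have key : (∑ i, ∑ j, c i * (starRingEnd ℂ) (c j) *
        (((1 + cos (b * (x i - x j))) * f (x i - x j) : ℝ) : ℂ)) =
      (∑ i, ∑ j, c i * (starRingEnd ℂ) (c j) * (f (x i - x j) : ℂ)) +
      ((1 / 2 : ℝ) : ℂ) * ((∑ i, ∑ j, (c i * Complex.exp ((b * x i : ℝ) * Complex.I)) *
        (starRingEnd ℂ) (c j * Complex.exp ((b * x j : ℝ) * Complex.I)) *
          (f (x i - x j) : ℂ)) +
      (∑ i, ∑ j, (c i * Complex.exp (-(b * x i : ℝ) * Complex.I)) *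
        (starRingEnd ℂ) (c j * Complex.exp (-(b * x j : ℝ) * Complex.I)) *
          (f (x i - x j) : ℂ))) := by
    rw [← Finset.sum_add_distrib, Finset.mul_sum, ← Finset.sum_add_distrib]
    refine Finset.sum_congr rfl fun i _ => ?_
    rw [← Finset.sum_add_distrib, Finset.mul_sum, ← Finset.sum_add_distrib]
    refine Finset.sum_congr rfl fun j _ => ?_
    have e₁ : Complex.exp ((b * (x i - x j) : ℂ) * Complex.I) =
        Complex.exp ((b * x i : ℝ) * Complex.I) * Complex.exp (-(b * x j : ℝ) * Complex.I) := by
      rw [← Complex.exp_add]; push_cast; ring_nf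
    have e₂ : Complex.exp (-(b * (x i - x j) : ℂ) * Complex.I) =
        Complex.exp (-(b * x i : ℝ) * Complex.I) * Complex.exp ((b * x j : ℝ) * Complex.I) := by
      rw [← Complex.exp_add]; push_cast; ring_nf
    simp only [map_mul, ← Complex.exp_conj, map_neg, Complex.conj_ofReal, Complex.conj_I,
      Complex.ofReal_mul, Complex.ofReal_add, Complex.ofReal_one, Complex.ofReal_cos,
      Complex.ofReal_sub, Complex.cos, mul_neg, neg_mul, neg_neg]
    push_cast
    simp only [neg_mul] at e₁ e₂ ⊢
    push_cast at e₁ e₂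
    simp only [e₁, e₂]
    ring
  rw [key, Complex.add_re, Complex.re_ofReal_mul, Complex.add_re]
  linarith

lemma isPosDefFn_one_add_cos_pow (b : ℝ) (N : ℕ) :
    IsPosDefFn (fun x => (1 + cos (b * x)) ^ N) := by
  induction N with
  | zero => simpa using isPosDefFn_one
  | succ N ih =>
    simp only [pow_succ']
    exact ih.one_add_cos_mul b

theorem lower_bound_G_integer (k : ℕ) (hk : 2 ≤ k) (δ : ℝ) (hδ : 0 < δ) :
    ∃ f : ℝ → ℝ, Continuous f ∧ IsDoublyPos f ∧ (0 < ∫ x in (-1 : ℝ)..1, f x) ∧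
      (2 * (k : ℝ) - 1 - δ) * ∫ x in (-1 : ℝ)..1, f x ≤
        ∫ x in (-(k : ℝ))..(k : ℝ), f x := by
  have hk' : (2 : ℝ) ≤ k := by exact_mod_cast hk
  have hpi := Real.pi_pos
  -- The period is chosen so that `[-k, k]` consists of exactly `2k - 1` periods.
  obtain ⟨p, hp⟩ : ∃ p : ℝ, (2 * (k : ℝ) - 1) * p = 2 * k :=
    ⟨2 * k / (2 * k - 1), by field_simp [show 2 * (k : ℝ) - 1 ≠ 0 by linarith]⟩
  have hp1 : 1 < p := by nlinarith
  have hp2 : p < 3 / 2 := by nlinarith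
  obtain ⟨b, hbp⟩ : ∃ b : ℝ, b * p = 2 * π :=
    ⟨2 * π / p, by field_simp⟩
  have hb : 0 < b := by
    by_contra! h
    nlinarith
  obtain ⟨t, ht⟩ : ∃ t : ℝ, t = (p - 1) / 2 := ⟨_, rfl⟩
  have ht0 : 0 < t := by linarith
  have hR0 : 0 ≤ 1 + cos (b * (p - 1)) := by linarith [neg_one_le_cos (b * (p - 1))]
  have hRQ : 1 + cos (b * (p - 1)) < 1 + cos (b * t) := by
    have := cos_lt_cos_of_nonneg_of_le_pi (x := b * t) (y := b * (p - 1))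
      (by positivity) (by nlinarith) (by nlinarith)
    linarith
  have hQ0 : 0 < 1 + cos (b * t) := hR0.trans_lt hRQ
  obtain ⟨N, hN⟩ := exists_pow_lt_of_lt_one
    (show 0 < δ * t / (2 * (k : ℝ) - 1) from div_pos (by positivity) (by linarith))
    ((div_lt_one hQ0).2 hRQ)
  rw [div_pow, div_lt_div_iff₀ (by positivity) (by linarith)] at hN
  set f : ℝ → ℝ := fun x => (1 + cos (b * x)) ^ N with hf
  have hcont : Continuous f := by fun_prop
  have hint : ∀ u v : ℝ, IntervalIntegrable f volume u v :=
    fun u v => hcont.intervalIntegrable u v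
  have hnonneg : ∀ x, 0 ≤ f x := fun x =>
    pow_nonneg (by linarith [neg_one_le_cos (b * x)]) N
  have hper : Function.Periodic f p := fun x => by
    simp only [hf]
    rw [mul_add, hbp, cos_add_two_pi]
  have hk_int : ∫ x in (-(k : ℝ))..(k : ℝ), f x =
      (2 * (k : ℝ) - 1) * ∫ x in (0 : ℝ)..p, f x := by
    have h := hper.intervalIntegral_add_zsmul_eq (2 * (k : ℤ) - 1) (-(k : ℝ)) (fun u v => hint u v)
    rw [hper.intervalIntegral_add_eq (-(k : ℝ)) 0] at h
    simp only [zsmul_eq_mul, zero_add] at h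
    push_cast at h
    rw [hp] at h
    rw [← h]
    congr 1
    ring
  have h1_int : ∫ x in (-1 : ℝ)..1, f x =
      (∫ x in (0 : ℝ)..p, f x) + ∫ x in (p - 1)..1, f x := by
    have h := hper.intervalIntegral_add_eq (-1) 0
    rw [zero_add] at h
    rw [← h, show -1 + p = p - 1 by ring]
    exact (intervalIntegral.integral_add_adjacent_intervals (hint _ _) (hint _ _)).symm
  have hJ : t * (1 + cos (b * t)) ^ N ≤ ∫ x in (0 : ℝ)..p, f x := by
    have h₁ : ∫ _ in (0 : ℝ)..t, (1 + cos (b * t)) ^ N ≤ ∫ x in (0 : ℝ)..t, f x := by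
      refine intervalIntegral.integral_mono_on ht0.le (by simp) (hint _ _) fun x hx => ?_
      refine pow_le_pow_left₀ hQ0.le ?_ N
      have := cos_le_cos_of_nonneg_of_le_pi (x := b * x) (y := b * t)
        (mul_nonneg hb.le hx.1) (by nlinarith) (by nlinarith [hx.2])
      linarith
    have h₂ : 0 ≤ ∫ x in t..p, f x :=
      intervalIntegral.integral_nonneg (by linarith) fun x _ => hnonneg x
    have h₃ := intervalIntegral.integral_add_adjacent_intervals (hint 0 t) (hint t p)
    simp only [intervalIntegral.integral_const, sub_zero, smul_eq_mul] at h₁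
    linarith
  have hE : ∫ x in (p - 1)..1, f x ≤ (1 + cos (b * (p - 1))) ^ N := by
    have h₁ : ∫ x in (p - 1)..1, f x ≤ ∫ _ in (p - 1)..1, (1 + cos (b * (p - 1))) ^ N := by
      refine intervalIntegral.integral_mono_on (by linarith) (hint _ _) (by simp) fun x hx => ?_
      refine pow_le_pow_left₀ (by linarith [neg_one_le_cos (b * x)]) ?_ N
      have hb0 : 0 ≤ b * (p - 1) := mul_nonneg hb.le (by linarith)
      have hlow : b * (p - 1) ≤ b * x := mul_le_mul_of_nonneg_left hx.1 hb.le
      have hup : b * x ≤ b * 1 := mul_le_mul_of_nonneg_left hx.2 hb.le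
      rcases le_total (b * x) π with h | h
      · linarith [cos_le_cos_of_nonneg_of_le_pi hb0 h hlow]
      · have := cos_le_cos_of_nonneg_of_le_pi (x := b * (p - 1)) (y := 2 * π - b * x)
          hb0 (by linarith) (by linarith)
        rw [cos_two_pi_sub] at this
        linarith
    simp only [intervalIntegral.integral_const, smul_eq_mul] at h₁
    nlinarith [pow_nonneg hR0 N]
  have hE0 : 0 ≤ ∫ x in (p - 1)..1, f x :=
    intervalIntegral.integral_nonneg (by linarith) fun x _ => hnonneg x
  have hJ0 : 0 < ∫ x in (0 : ℝ)..p, f x := lt_of_lt_of_le (by positivity) hJ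
  refine ⟨f, hcont, ⟨isPosDefFn_one_add_cos_pow b N, hnonneg⟩, by linarith, ?_⟩
  rw [h1_int, hk_int]
  have h₁ := mul_le_mul_of_nonneg_left hJ hδ.le
  have h₂ := mul_le_mul_of_nonneg_left hE (show 0 ≤ 2 * (k : ℝ) - 1 by linarith)
  have h₃ := mul_nonneg hδ.le hE0
  linarith
end

section
/- (Gorbachev) For every continuous doubly positive function f : ℝ → ℝ and every L > 0, one has ∫_{-2L}^{2L} f(x) dx ≤ π² · ∫_{-L}^{L} f(x) dx. -/
open MeasureTheory Real

lemma IsPosDefFn.sum_nonneg {f : ℝ → ℝ} (hf : IsPosDefFn f) {ι : Type*} [Fintype ι]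
    (x c : ι → ℝ) : 0 ≤ ∑ i, ∑ j, c i * c j * f (x i - x j) := by
  let e := (Fintype.equivFin ι).symm
  have h := hf (Fintype.card ι) (fun i => x (e i)) (fun i => (c (e i) : ℂ))
  have h2 : ∑ i, ∑ j, c i * c j * f (x i - x j)
      = ∑ i, ∑ j, c (e i) * c (e j) * f (x (e i) - x (e j)) := by
    rw [← e.sum_comp]
    refine Finset.sum_congr rfl fun i _ => ?_
    rw [← e.sum_comp]
  rw [h2]
  simp only [Complex.conj_ofReal] at h
  exact_mod_cast h

/-- The second difference `2 f - f (· + t) - f (· - t)` of a positive definite function has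
nonnegative sums over all pairs from a finite family of points. -/
lemma IsPosDefFn.sum_second_difference_nonneg {f : ℝ → ℝ} (hf : IsPosDefFn f) (t : ℝ)
    {ι : Type*} [Fintype ι] (x : ι → ℝ) :
    0 ≤ ∑ i, ∑ j, (2 * f (x i - x j) - f (x i - x j + t) - f (x i - x j - t)) := by
  have h := hf.sum_nonneg (Sum.elim x fun i => x i - t)
    (Sum.elim (fun _ : ι => 1) fun _ : ι => -1)
  simp only [Fintype.sum_sum_type, Sum.elim_inl, Sum.elim_inr, ← Finset.sum_add_distrib] at h
  refine h.trans_eq (Finset.sum_congr rfl fun i _ => Finset.sum_congr rfl fun j _ => ?_)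
  rw [show x i - (x j - t) = x i - x j + t by ring, show x i - t - x j = x i - x j - t by ring,
    show x i - t - (x j - t) = x i - x j by ring]
  ring

lemma continuous_integral_sub {K : ℝ → ℝ} (hK : Continuous K) (a b : ℝ) :
    Continuous fun x => ∫ y in a..b, K (x - y) :=
  intervalIntegral.continuous_parametric_intervalIntegral_of_continuous' (by fun_prop) a b

lemma integral_integral_sub_nonneg {K : ℝ → ℝ} (hK : Continuous K)
    (hsum : ∀ (n : ℕ) (x : Fin n → ℝ), 0 ≤ ∑ i, ∑ j, K (x i - x j)) {L : ℝ} (hL : 0 < L) :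
    0 ≤ ∫ x in (0 : ℝ)..L, ∫ y in (0 : ℝ)..L, K (x - y) := by
  suffices H : ∀ ε > 0, 0 ≤ (∫ x in (0 : ℝ)..L, ∫ y in (0 : ℝ)..L, K (x - y)) + L ^ 2 * ε by
    refine le_of_forall_pos_le_add fun ε hε => ?_
    have := H (ε / L ^ 2) (by positivity)
    rwa [mul_div_cancel₀ _ (by positivity)] at this
  intro ε hε
  have huc := (isCompact_Icc (a := -L) (b := L)).uniformContinuousOn_of_continuous hK.continuousOn
  obtain ⟨δ, hδ, hKδ⟩ := Metric.uniformContinuousOn_iff.1 huc ε hε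
  obtain ⟨n, hn⟩ := exists_nat_gt (L / δ)
  have hn0 : (0 : ℝ) < n := (by positivity : 0 < L / δ).trans hn
  set h := L / n with hh
  have hh0 : 0 < h := by positivity
  have hhδ : h < δ := by
    rw [div_lt_iff₀ hδ] at hn
    rw [hh, div_lt_iff₀ hn0]
    linarith
  have hnh : n * h = L := by rw [hh]; field_simp
  have split : ∀ g : ℝ → ℝ, Continuous g → ∫ x in (0 : ℝ)..L, g x
      = ∑ i : Fin n, ∫ x in ((i : ℕ) * h)..(((i : ℕ) + 1) * h), g x := by
    intro g hg
    have := intervalIntegral.sum_integral_adjacent_intervals (f := g) (μ := volume)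
      (a := fun k : ℕ => (k : ℝ) * h) (n := n) fun k _ => hg.intervalIntegrable _ _
    rw [Fin.sum_univ_eq_sum_range
      (fun k : ℕ => ∫ x in ((k : ℝ) * h)..(((k : ℝ) + 1) * h), g x)]
    simpa [hnh] using this.symm
  have lower : ∀ (g : ℝ → ℝ) (i : Fin n) (m : ℝ), Continuous g →
      (∀ x ∈ Set.Icc ((i : ℕ) * h) (((i : ℕ) + 1) * h), m ≤ g x) →
      h * m ≤ ∫ x in ((i : ℕ) * h)..(((i : ℕ) + 1) * h), g x := by
    intro g i m hg hm
    have := intervalIntegral.integral_mono_on (μ := volume) (f := fun _ => m) (g := g)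
      (a := (i : ℕ) * h) (b := ((i : ℕ) + 1) * h) (by nlinarith) (by simp)
      (hg.intervalIntegrable _ _) hm
    rw [intervalIntegral.integral_const, smul_eq_mul] at this
    linarith
  have cell : ∀ (i : Fin n), ∀ x ∈ Set.Icc ((i : ℕ) * h) (((i : ℕ) + 1) * h), 0 ≤ x ∧ x ≤ L := by
    intro i x hx
    have h1 : ((i : ℕ) : ℝ) + 1 ≤ n := by exact_mod_cast i.2
    have h2 : (((i : ℕ) : ℝ) + 1) * h ≤ n * h := by gcongr
    have h3 : 0 ≤ ((i : ℕ) : ℝ) * h := by positivity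
    exact ⟨h3.trans hx.1, by linarith [hx.2]⟩
  have key : ∑ i : Fin n, h * ∑ j : Fin n, h * (K ((i : ℕ) * h - (j : ℕ) * h) - ε)
      ≤ ∫ x in (0 : ℝ)..L, ∫ y in (0 : ℝ)..L, K (x - y) := by
    rw [split _ (continuous_integral_sub hK 0 L)]
    refine Finset.sum_le_sum fun i _ => lower _ i _ (continuous_integral_sub hK 0 L) ?_
    intro x hx
    rw [split (fun y => K (x - y)) (by fun_prop)]
    refine Finset.sum_le_sum fun j _ => lower _ j _ (by fun_prop) ?_
    intro y hy
    have hi := cell i x hx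
    have hj := cell j y hy
    have hi' := cell i ((i : ℕ) * h) ⟨le_rfl, by linarith⟩
    have hj' := cell j ((j : ℕ) * h) ⟨le_rfl, by linarith⟩
    have hd := hKδ (x - y) ⟨by linarith, by linarith⟩ ((i : ℕ) * h - (j : ℕ) * h)
      ⟨by linarith, by linarith⟩ (by
        rw [Real.dist_eq, abs_lt]
        constructor <;> linarith [hx.1, hx.2, hy.1, hy.2])
    rw [Real.dist_eq, abs_lt] at hd
    linarith
  have hcalc : ∑ i : Fin n, h * ∑ j : Fin n, h * (K ((i : ℕ) * h - (j : ℕ) * h) - ε)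
      = h ^ 2 * (∑ i : Fin n, ∑ j : Fin n, K ((i : ℕ) * h - (j : ℕ) * h)) - L ^ 2 * ε := by
    simp only [← Finset.mul_sum, Finset.sum_sub_distrib, Finset.sum_const, Finset.card_univ,
      Fintype.card_fin, nsmul_eq_mul]
    rw [← hnh]
    ring
  have := mul_nonneg (sq_nonneg h) (hsum n fun i => (i : ℕ) * h)
  linarith

/-- For a positive definite `f`, the average of `f (· + t)` and `f (· - t)` against the
difference kernel of `[0, L]` is at most that of `f`. -/
lemma IsPosDefFn.integral_shift_le {f : ℝ → ℝ} (hf : IsPosDefFn f) (hc : Continuous f)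
    {L : ℝ} (hL : 0 < L) (t : ℝ) :
    (∫ x in (0 : ℝ)..L, ∫ y in (0 : ℝ)..L, f (x - y + t))
      + (∫ x in (0 : ℝ)..L, ∫ y in (0 : ℝ)..L, f (x - y - t))
      ≤ 2 * ∫ x in (0 : ℝ)..L, ∫ y in (0 : ℝ)..L, f (x - y) := by
  have h := integral_integral_sub_nonneg
    (K := fun u => 2 * f u - f (u + t) - f (u - t)) (by fun_prop)
    (fun n x => hf.sum_second_difference_nonneg t x) hL
  have hinner : ∀ x : ℝ, ∫ y in (0 : ℝ)..L, (2 * f (x - y) - f (x - y + t) - f (x - y - t))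
      = 2 * (∫ y in (0 : ℝ)..L, f (x - y)) - (∫ y in (0 : ℝ)..L, f (x - y + t))
        - ∫ y in (0 : ℝ)..L, f (x - y - t) := by
    intro x
    rw [intervalIntegral.integral_sub, intervalIntegral.integral_sub,
      intervalIntegral.integral_const_mul]
    all_goals exact Continuous.intervalIntegrable (by fun_prop) _ _
  have c0 := continuous_integral_sub hc 0 L
  have c1 := continuous_integral_sub (K := fun u => f (u + t)) (by fun_prop) 0 L
  have c2 := continuous_integral_sub (K := fun u => f (u - t)) (by fun_prop) 0 L
  simp only [hinner] at h
  rw [intervalIntegral.integral_sub ((by fun_prop : Continuous _).intervalIntegrable _ _)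
      (c2.intervalIntegrable _ _),
    intervalIntegral.integral_sub ((by fun_prop : Continuous _).intervalIntegrable _ _)
      (c1.intervalIntegrable _ _),
    intervalIntegral.integral_const_mul] at h
  linarith

/-- The doubling inequality with constant `5`. -/
lemma IsDoublyPos.integral_two_mul_le {f : ℝ → ℝ} (hdp : IsDoublyPos f) (hf : Continuous f)
    {L : ℝ} (hL : 0 < L) :
    ∫ x in (-(2 * L))..(2 * L), f x ≤ 5 * ∫ x in (-L)..L, f x := by
  obtain ⟨hpd, hpos⟩ := hdp
  have hii : ∀ a b : ℝ, IntervalIntegrable f volume a b := hf.intervalIntegrable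
  have mono : ∀ {a b c d : ℝ}, c ≤ a → a ≤ b → b ≤ d → ∫ x in a..b, f x ≤ ∫ x in c..d, f x :=
    fun h1 h2 h3 => intervalIntegral.integral_mono_interval h1 h2 h3
      (Filter.Eventually.of_forall hpos) (hii _ _)
  have shift : ∀ t x : ℝ, ∫ y in (0 : ℝ)..L, f (x - y + t) = ∫ u in (x - L + t)..(x + t), f u := by
    intro t x
    have := intervalIntegral.integral_comp_sub_left (a := 0) (b := L) f (x + t)
    simp only [sub_zero] at this
    rw [show x - L + t = x + t - L by ring, ← this]
    exact intervalIntegral.integral_congr fun y _ => by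
      show f _ = f _
      congr 1
      ring
  have hcont : ∀ t : ℝ, Continuous fun x => ∫ y in (0 : ℝ)..L, f (x - y + t) := fun t =>
    continuous_integral_sub (K := fun u => f (u + t)) (by fun_prop) 0 L
  set A : ℝ → ℝ := fun t => ∫ x in (0 : ℝ)..L, ∫ y in (0 : ℝ)..L, f (x - y + t) with hA
  have hAle : ∀ t, A t + A (-t) ≤ 2 * A 0 := by
    intro t
    have := hpd.integral_shift_le hf hL t
    simpa only [hA, add_zero, ← sub_eq_add_neg] using this
  have hA0 : A 0 ≤ L * ∫ x in (-L)..L, f x := by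
    have := intervalIntegral.integral_mono_on (μ := volume) hL.le
      ((hcont 0).intervalIntegrable 0 L)
      (intervalIntegrable_const (c := ∫ x in (-L)..L, f x)) fun x hx => by
        rw [shift]
        exact mono (by linarith [hx.1]) (by linarith) (by linarith [hx.2])
    simpa [hA] using this
  have hAsum : L * ∫ x in (-(2 * L))..(2 * L), f x
      ≤ A (-(2 * L)) + A (-L) + A 0 + A L + A (2 * L) := by
    have hi : ∀ t, IntervalIntegrable (fun x => ∫ y in (0 : ℝ)..L, f (x - y + t)) volume 0 L :=
      fun t => (hcont t).intervalIntegrable _ _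
    simp only [hA]
    rw [← intervalIntegral.integral_add (hi _) (hi _),
      ← intervalIntegral.integral_add ((hi _).add (hi _)) (hi _),
      ← intervalIntegral.integral_add (((hi _).add (hi _)).add (hi _)) (hi _),
      ← intervalIntegral.integral_add ((((hi _).add (hi _)).add (hi _)).add (hi _)) (hi _)]
    have := intervalIntegral.integral_mono_on (μ := volume) hL.le
      (intervalIntegrable_const (c := ∫ x in (-(2 * L))..(2 * L), f x))
      (((((hi (-(2 * L))).add (hi (-L))).add (hi 0)).add (hi L)).add (hi (2 * L))) fun x hx => by
        simp only [shift]
        rw [show x - L + -L = x + -(2 * L) by ring, show x - L + 0 = x + -L by ring,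
          show x - L + L = x + 0 by ring, show x - L + 2 * L = x + L by ring,
          intervalIntegral.integral_add_adjacent_intervals (hii _ _) (hii _ _),
          intervalIntegral.integral_add_adjacent_intervals (hii _ _) (hii _ _),
          intervalIntegral.integral_add_adjacent_intervals (hii _ _) (hii _ _),
          intervalIntegral.integral_add_adjacent_intervals (hii _ _) (hii _ _)]
        exact mono (by linarith [hx.2]) (by linarith) (by linarith [hx.1])
    simpa using this
  refine le_of_mul_le_mul_left ?_ hL
  linarith [hAle L, hAle (2 * L)]

theorem gorbachev (f : ℝ → ℝ) (hf : Continuous f) (hdp : IsDoublyPos f)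
    (L : ℝ) (hL : 0 < L) :
    ∫ x in (-(2 * L))..(2 * L), f x ≤ π ^ 2 * ∫ x in (-L)..L, f x := by
  refine (hdp.integral_two_mul_le hf hL).trans ?_
  gcongr
  · exact intervalIntegral.integral_nonneg (by linarith) fun x _ => hdp.2 x
  · nlinarith [pi_gt_three]
end

section
/- Let T(x) = max(1 − |x|, 0), h_a(x) = 2·T(x) − T(x + a) − T(x − a), and let 0 < p ≤ 1, k ∈ ℕ, a ∈ ℝ. Then for every x ∈ ℝ one has ∑_{j=0}^{k} h_{a + j(2−p)}(x) ≤ 2(k+1)·χ_{[-1,1]}(x) − p·( χ_{[a−1+p, a+k(2−p)+1−p]}(x) + χ_{[−a−k(2−p)−1+p, 1−a−p]}(x) ), where χ_J denotes the characteristic (indicator) function of the interval J. -/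
/-- The triangle function `T(x) = max(1 - |x|, 0)`. -/
noncomputable def triFn (x : ℝ) : ℝ := max (1 - |x|) 0

/-- `hFn a x = 2 T(x) - T(x+a) - T(x-a)`. -/
noncomputable def hFn (a x : ℝ) : ℝ := 2 * triFn x - triFn (x + a) - triFn (x - a)

/-- Characteristic function of the closed interval `[s, t]`. -/
noncomputable def chi (s t x : ℝ) : ℝ := if x ∈ Set.Icc s t then 1 else 0

theorem triFn_nonneg (x : ℝ) : 0 ≤ triFn x := le_max_right _ _

theorem one_sub_abs_le_triFn (x : ℝ) : 1 - |x| ≤ triFn x := le_max_left _ _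

theorem triFn_neg (x : ℝ) : triFn (-x) = triFn x := by
  simp only [triFn, abs_neg]

theorem triFn_le_chi (x : ℝ) : triFn x ≤ chi (-1) 1 x := by
  unfold triFn chi
  split_ifs with h
  · exact max_le (by linarith [abs_nonneg x]) zero_le_one
  · refine max_le ?_ le_rfl
    rw [Set.mem_Icc, ← abs_le] at h
    linarith

/-- Triangles of half-width `1` spaced by `2 - p` add up to at least `p` between the outermost
centers, and up to distance `1 - p` beyond them. -/
theorem le_sum_triFn_sub {p : ℝ} (hp1 : p ≤ 1) (k : ℕ) {a x : ℝ}
    (hl : a - 1 + p ≤ x) (hr : x ≤ a + (k : ℝ) * (2 - p) + 1 - p) :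
    p ≤ ∑ j ∈ Finset.range (k + 1), triFn (x - (a + (j : ℝ) * (2 - p))) := by
  induction k with
  | zero =>
    simp only [Nat.cast_zero, zero_mul, add_zero, zero_add, Finset.sum_range_one] at hr ⊢
    have h : |x - a| ≤ 1 - p := abs_le.2 ⟨by linarith, by linarith⟩
    linarith [one_sub_abs_le_triFn (x - a)]
  | succ k ih =>
    rw [Finset.sum_range_succ]
    by_cases hx : x ≤ a + (k : ℝ) * (2 - p) + 1 - p
    · linarith [ih hx, triFn_nonneg (x - (a + ((k + 1 : ℕ) : ℝ) * (2 - p)))]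
    rw [Finset.sum_range_succ]
    have h0 : 0 ≤ ∑ j ∈ Finset.range k, triFn (x - (a + (j : ℝ) * (2 - p))) :=
      Finset.sum_nonneg fun j _ => triFn_nonneg _
    push_cast at hr ⊢
    have h1 := one_sub_abs_le_triFn (x - (a + (k : ℝ) * (2 - p)))
    have h2 := one_sub_abs_le_triFn (x - (a + ((k : ℝ) + 1) * (2 - p)))
    rw [abs_of_nonneg (by linarith)] at h1
    rcases le_total x (a + ((k : ℝ) + 1) * (2 - p)) with h | h
    · rw [abs_of_nonpos (by linarith)] at h2
      linarith
    · rw [abs_of_nonneg (by linarith)] at h2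
      linarith [triFn_nonneg (x - (a + (k : ℝ) * (2 - p)))]

theorem mul_chi_le_sum_triFn_sub {p : ℝ} (hp1 : p ≤ 1) (k : ℕ) (a x : ℝ) :
    p * chi (a - 1 + p) (a + (k : ℝ) * (2 - p) + 1 - p) x ≤
      ∑ j ∈ Finset.range (k + 1), triFn (x - (a + (j : ℝ) * (2 - p))) := by
  unfold chi
  split_ifs with h
  · simpa using le_sum_triFn_sub hp1 k h.1 h.2
  · simpa using Finset.sum_nonneg fun j (_ : j ∈ Finset.range (k + 1)) =>
      triFn_nonneg (x - (a + (j : ℝ) * (2 - p)))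

theorem chi_neg (s t x : ℝ) : chi s t (-x) = chi (-t) (-s) x := by
  have h : -x ∈ Set.Icc s t ↔ x ∈ Set.Icc (-t) (-s) := by
    rw [Set.mem_Icc, Set.mem_Icc, le_neg, neg_le, and_comm]
  simp only [chi, h]

theorem key_pointwise_estimate (p : ℝ) (hp0 : 0 < p) (hp1 : p ≤ 1) (k : ℕ) (a x : ℝ) :
    ∑ j ∈ Finset.range (k + 1), hFn (a + (j : ℝ) * (2 - p)) x ≤
      2 * ((k : ℝ) + 1) * chi (-1) 1 x -
        p * (chi (a - 1 + p) (a + (k : ℝ) * (2 - p) + 1 - p) x +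
             chi (-a - (k : ℝ) * (2 - p) - 1 + p) (1 - a - p) x) := by
  have h1 := mul_chi_le_sum_triFn_sub hp1 k a x
  have h2 := mul_chi_le_sum_triFn_sub hp1 k a (-x)
  rw [chi_neg, show -(a + (k : ℝ) * (2 - p) + 1 - p) = -a - (k : ℝ) * (2 - p) - 1 + p by ring,
    show -(a - 1 + p) = 1 - a - p by ring] at h2
  have h3 : ∀ j : ℕ, triFn (-x - (a + (j : ℝ) * (2 - p))) = triFn (x + (a + (j : ℝ) * (2 - p))) :=
    fun j => by rw [← triFn_neg (x + _), neg_add, sub_eq_add_neg]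
  simp only [h3] at h2
  have h4 : 2 * ((k : ℝ) + 1) * triFn x ≤ 2 * ((k : ℝ) + 1) * chi (-1) 1 x :=
    mul_le_mul_of_nonneg_left (triFn_le_chi x) (by positivity)
  simp only [hFn, Finset.sum_sub_distrib, Finset.sum_const, Finset.card_range, nsmul_eq_mul]
  push_cast
  linarith
end

section
/- Let ℓ > 1 be a real number and define φ(x) = (x+1)(x+2)/(x+1−ℓ) for x ∈ (ℓ−1, 2ℓ]. Then for every integer n with ℓ − 1 < n ≤ 2ℓ one has φ(⌊2ℓ⌋) ≤ φ(n); that is, among integers in (ℓ−1, 2ℓ], the function φ attains its minimum at the integer ⌊2ℓ⌋. -/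
theorem phi_min_at_floor (ℓ : ℝ) (hℓ : 1 < ℓ) (n : ℤ) (hn1 : ℓ - 1 < (n : ℝ))
    (hn2 : (n : ℝ) ≤ 2 * ℓ) :
    ((⌊2 * ℓ⌋ : ℝ) + 1) * ((⌊2 * ℓ⌋ : ℝ) + 2) / ((⌊2 * ℓ⌋ : ℝ) + 1 - ℓ) ≤
      ((n : ℝ) + 1) * ((n : ℝ) + 2) / ((n : ℝ) + 1 - ℓ) := by
  have hm : (⌊2 * ℓ⌋ : ℝ) ≤ 2 * ℓ := Int.floor_le _
  have hnm : n ≤ ⌊2 * ℓ⌋ := Int.le_floor.2 hn2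
  generalize ⌊2 * ℓ⌋ = m at hm hnm ⊢
  rcases hnm.eq_or_lt with rfl | hlt
  · exact le_rfl
  have hlt' : (n : ℝ) + 1 ≤ m := by exact_mod_cast hlt
  have hA : 0 < (n : ℝ) + 1 - ℓ := by linarith
  have hB : 0 < (m : ℝ) + 1 - ℓ := by linarith
  have hAB : ((n : ℝ) + 1 - ℓ) * ((m : ℝ) + 1 - ℓ) ≤ ℓ * (ℓ + 1) :=
    mul_le_mul (by linarith) (by linarith) hB.le (by linarith)
  rw [div_le_div_iff₀ hB hA]
  have hmn : 0 ≤ (m : ℝ) - n := by linarith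
  linarith [mul_nonneg hmn (sub_nonneg.2 hAB)]
end

section
/- Let ℓ > 0, A ∈ ℝ, B > 0, and let H : ℝ → ℝ be a continuous, integrable, positive definite function, not identically zero, satisfying H(x) ≤ A·χ_{[-1,1]}(x) − B·χ_{[-ℓ,ℓ]}(x) for all x ∈ ℝ. Then A ≥ B·ℓ. In particular, the extremal quantity γ(ℓ) := inf{A/B : ∃ H positive definite with H ≤ A·χ_{[-1,1]} − B·χ_{[-ℓ,ℓ]}} satisfies γ(ℓ) ≥ ℓ. -/
open MeasureTheory Real

theorem IsPosDefFn.sum_range_nonneg {f : ℝ → ℝ} (hf : IsPosDefFn f) (n : ℕ) (h : ℝ) :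
    0 ≤ ∑ i ∈ Finset.range n, ∑ j ∈ Finset.range n, f (((i : ℝ) - j) * h) := by
  have key := hf n (fun i => (i : ℕ) * h) (fun _ => 1)
  simp only [map_one, one_mul, Complex.re_sum, Complex.ofReal_re, ← sub_mul] at key
  rw [← Fin.sum_univ_eq_sum_range (fun i => ∑ j ∈ Finset.range n, f (((i : ℝ) - j) * h))]
  simp_rw [← Fin.sum_univ_eq_sum_range (fun j => f (((_ : ℝ) - (j : ℝ)) * h))]
  exact key

theorem chi_nonneg (s t x : ℝ) : 0 ≤ chi s t x := by
  unfold chi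
  split_ifs <;> norm_num

/-- A point of a lattice of mesh `1 / M` has at most `2 * M + 1` lattice points within
distance `1`. -/
theorem sum_range_chi_one_le (n i M : ℕ) (hM : 0 < M) :
    ∑ j ∈ Finset.range n, chi (-1) 1 (((i : ℝ) - j) * (M : ℝ)⁻¹) ≤ 2 * M + 1 := by
  have hM' : (0 : ℝ) < M := Nat.cast_pos.mpr hM
  simp only [chi, Finset.sum_boole]
  have hsub : (Finset.range n).filter
      (fun j : ℕ => ((i : ℝ) - j) * (M : ℝ)⁻¹ ∈ Set.Icc (-1 : ℝ) 1) ⊆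
        Finset.Icc (i - M) (i + M) := by
    intro j hj
    obtain ⟨-, h₁, h₂⟩ := Finset.mem_filter.mp hj
    rw [← div_eq_mul_inv, le_div_iff₀ hM'] at h₁
    rw [← div_eq_mul_inv, div_le_iff₀ hM'] at h₂
    have h₃ : (j : ℝ) ≤ (i + M : ℕ) := by push_cast; linarith
    have h₄ : (i : ℝ) ≤ (j + M : ℕ) := by push_cast; linarith
    have := Nat.cast_le.mp h₃
    have := Nat.cast_le.mp h₄
    rw [Finset.mem_Icc]
    omega
  have hcard := Finset.card_le_card hsub
  rw [Nat.card_Icc] at hcard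
  have hle : _ ≤ 2 * M + 1 := hcard.trans (by omega)
  exact_mod_cast hle

theorem le_sum_range_chi (n i K : ℕ) (h ℓ : ℝ) (hh : 0 ≤ h) (hK : K * h ≤ ℓ)
    (hi : K ≤ i) (hin : i + K < n) :
    2 * K + 1 ≤ ∑ j ∈ Finset.range n, chi (-ℓ) ℓ (((i : ℝ) - j) * h) := by
  simp only [chi, Finset.sum_boole]
  have hsub : Finset.Icc (i - K) (i + K) ⊆ (Finset.range n).filter
      (fun j : ℕ => ((i : ℝ) - j) * h ∈ Set.Icc (-ℓ) ℓ) := by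
    intro j hj
    rw [Finset.mem_Icc] at hj
    have h₁ : (j : ℝ) ≤ i + K := by exact_mod_cast hj.2
    have h₂ : (i : ℝ) ≤ j + K := by exact_mod_cast (show i ≤ j + K by omega)
    refine Finset.mem_filter.mpr ⟨Finset.mem_range.mpr (by omega), ?_, ?_⟩ <;> nlinarith
  have hcard := Finset.card_le_card hsub
  rw [Nat.card_Icc] at hcard
  have hle : 2 * K + 1 ≤ _ := le_trans (by omega) hcard
  exact_mod_cast hle

theorem nonpos_of_forall_nat_mul_le {x c : ℝ} (h : ∀ N : ℕ, 0 < N → N * x ≤ c) : x ≤ 0 := by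
  by_contra! hx
  obtain ⟨N, hN⟩ := exists_nat_gt (c / x)
  rw [div_lt_iff₀ hx] at hN
  have := h (N + 1) N.succ_pos
  push_cast at this
  linarith

/-- The pointwise bound, summed over the differences of `N + 2 * K` points of a lattice of mesh
`1 / M`. -/
theorem IsPosDefFn.mul_card_le_mul_card {ℓ A B : ℝ} (hA : 0 ≤ A) (hB : 0 ≤ B) {H : ℝ → ℝ}
    (hH : IsPosDefFn H) (hbound : ∀ x, H x ≤ A * chi (-1) 1 x - B * chi (-ℓ) ℓ x)
    (N K M : ℕ) (hM : 0 < M) (hK : K * (M : ℝ)⁻¹ ≤ ℓ) :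
    B * (N * (2 * K + 1)) ≤ A * ((N + 2 * K) * (2 * M + 1)) := by
  have hsum : 0 ≤ A * ∑ i ∈ Finset.range (N + 2 * K), ∑ j ∈ Finset.range (N + 2 * K),
        chi (-1) 1 (((i : ℝ) - j) * (M : ℝ)⁻¹) -
      B * ∑ i ∈ Finset.range (N + 2 * K), ∑ j ∈ Finset.range (N + 2 * K),
        chi (-ℓ) ℓ (((i : ℝ) - j) * (M : ℝ)⁻¹) := by
    refine (hH.sum_range_nonneg (N + 2 * K) (M : ℝ)⁻¹).trans ?_
    simp only [Finset.mul_sum, ← Finset.sum_sub_distrib]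
    exact Finset.sum_le_sum fun i _ => Finset.sum_le_sum fun j _ => hbound _
  have hupper : ∑ i ∈ Finset.range (N + 2 * K), ∑ j ∈ Finset.range (N + 2 * K),
      chi (-1) 1 (((i : ℝ) - j) * (M : ℝ)⁻¹) ≤ (N + 2 * K) * (2 * M + 1) := by
    refine (Finset.sum_le_card_nsmul _ _ _
      fun i _ => sum_range_chi_one_le (N + 2 * K) i M hM).trans_eq ?_
    rw [Finset.card_range, nsmul_eq_mul]
    push_cast
    ring
  have hlower : N * (2 * K + 1) ≤ ∑ i ∈ Finset.range (N + 2 * K),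
      ∑ j ∈ Finset.range (N + 2 * K), chi (-ℓ) ℓ (((i : ℝ) - j) * (M : ℝ)⁻¹) := by
    have hsub : Finset.Ico K (N + K) ⊆ Finset.range (N + 2 * K) := by
      intro i hi
      rw [Finset.mem_Ico] at hi
      rw [Finset.mem_range]
      omega
    refine le_trans ?_ (Finset.sum_le_sum_of_subset_of_nonneg hsub
      fun i _ _ => Finset.sum_nonneg fun j _ => chi_nonneg _ _ _)
    refine le_trans (le_of_eq ?_) (Finset.card_nsmul_le_sum _ _ (2 * K + 1 : ℝ) fun i hi => ?_)
    · rw [Nat.card_Ico, Nat.add_sub_cancel, nsmul_eq_mul]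
    · rw [Finset.mem_Ico] at hi
      exact le_sum_range_chi _ i K _ ℓ (by positivity) hK hi.1 (by omega)
  have := mul_le_mul_of_nonneg_left hupper hA
  have := mul_le_mul_of_nonneg_left hlower hB
  linarith

theorem auxiliary_lower_bound_gamma (ℓ : ℝ) (hℓ : 0 < ℓ) (A B : ℝ) (hB : 0 < B)
    (H : ℝ → ℝ) (hHc : Continuous H) (hHi : Integrable H) (hHpd : IsPosDefFn H)
    (hH0 : H ≠ 0)
    (hbound : ∀ x : ℝ, H x ≤ A * chi (-1) 1 x - B * chi (-ℓ) ℓ x) :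
    B * ℓ ≤ A := by
  have hA : 0 ≤ A := by
    have h₀ := hHpd.sum_range_nonneg 1 0
    have h₁ := hbound 0
    simp [chi, hℓ.le] at h₀ h₁
    linarith
  suffices h : B * ℓ - A ≤ 0 by linarith
  refine nonpos_of_forall_nat_mul_le (c := (A + B) / 2) fun M hM => ?_
  have hM' : (0 : ℝ) < M := Nat.cast_pos.mpr hM
  set K := ⌊ℓ * M⌋₊
  have hK : K * (M : ℝ)⁻¹ ≤ ℓ := by
    rw [← div_eq_mul_inv, div_le_iff₀ hM']
    exact Nat.floor_le (by positivity)
  have hrow : B * (2 * K + 1) - A * (2 * M + 1) ≤ 0 := by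
    refine nonpos_of_forall_nat_mul_le (c := A * (2 * K * (2 * M + 1))) fun N _ => ?_
    have := hHpd.mul_card_le_mul_card hA hB.le hbound N K M hM hK
    linarith
  have hfloor := mul_le_mul_of_nonneg_left (Nat.lt_floor_add_one (ℓ * M)).le hB.le
  linarith
end
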